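/- Let k ≥ 1, let τ' be a symmetric k×k complex matrix with positive definite imaginary part, let b ∈ ℂ^k, and for t ∈ ℝ let τ(t) be the symmetric (k+1)×(k+1) complex matrix with (1,1)-entry it, first row/column off-diagonal entries given by b, and lower-right k×k block τ'. Let ε = (0, ε̃) and δ = (y, δ̃) with ε̃, δ̃ ∈ {0,1}^k and y ∈ {0,1}. Then as t → ∞ the theta constant θ[ε;δ](τ(t)) = Σ_{n ∈ ℤ^{k+1}} exp(πi((n + ε/2)ᵀ τ(t) (n + ε/2) + (n + ε/2)·δ)) converges to the genus-k theta constant θ[ε̃;δ̃](τ') = Σ_{m ∈ ℤ^k} exp(πi((m + ε̃/2)ᵀ τ' (m + ε̃/2) + (m + ε̃/2)·δ̃)). -/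

import Mathlib

open scoped Real

/-- The degenerating period matrix `τ(t) = [[it, bᵀ], [b, τ']]`, indexed by
`Fin 1 ⊕ Fin k`. -/
def degMatrix (k : ℕ) (τ' : Matrix (Fin k) (Fin k) ℂ) (b : Fin k → ℂ) (t : ℝ) :
    Matrix (Fin 1 ⊕ Fin k) (Fin 1 ⊕ Fin k) ℂ :=
  Matrix.fromBlocks (Matrix.of fun _ _ => (t : ℂ) * Complex.I)
    (Matrix.of fun _ j => b j) (Matrix.of fun i _ => b i) τ'


lemma summable_pi_prod_fin (n : ℕ) (f : Fin n → ℤ → ℝ) (h0 : ∀ i m, 0 ≤ f i m)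
    (hs : ∀ i, Summable (f i)) : Summable (fun m : Fin n → ℤ => ∏ i, f i (m i)) := by
  induction n with
  | zero => exact Summable.of_finite
  | succ n ih =>
    have h := (hs 0).mul_of_nonneg (ih (fun i => f i.succ) (fun i => h0 _) (fun i => hs _))
      (h0 0) (fun m => Finset.prod_nonneg fun i _ => h0 _ _)
    rw [← (Fin.consEquiv (fun _ : Fin (n+1) => ℤ)).summable_iff]
    refine h.congr fun p => ?_
    simp [Fin.prod_univ_succ, Fin.consEquiv]

lemma summable_pi_prod {ι : Type*} [Fintype ι] (f : ι → ℤ → ℝ) (h0 : ∀ i m, 0 ≤ f i m)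
    (hs : ∀ i, Summable (f i)) : Summable (fun m : ι → ℤ => ∏ i, f i (m i)) := by
  have e := Fintype.equivFin ι
  have h := summable_pi_prod_fin _ (fun i => f (e.symm i)) (fun i => h0 _) (fun i => hs _)
  rw [← (e.arrowCongr (Equiv.refl ℤ)).summable_iff] at h
  refine h.congr fun p => ?_
  simp only [Function.comp, Equiv.arrowCongr_apply, Equiv.refl_apply]
  exact Equiv.prod_comp e.symm (fun i => f i (p i))

lemma posdef_bound {k : ℕ} (A : Matrix (Fin k) (Fin k) ℝ) (hA : A.PosDef) :
    ∃ c : ℝ, 0 < c ∧ ∀ x : Fin k → ℝ, c * ∑ i, x i ^ 2 ≤ ∑ i, ∑ j, x i * A i j * x j := by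
  have key : ∀ x : Fin k → ℝ, x ≠ 0 → 0 < ∑ i, ∑ j, x i * A i j * x j := by
    intro x hx
    have := hA.dotProduct_mulVec_pos hx
    simpa [dotProduct, Matrix.mulVec, Finset.mul_sum, mul_assoc] using this
  obtain ⟨c, hc, h⟩ := (isCompact_sphere (0 : EuclideanSpace ℝ (Fin k)) 1).exists_forall_le'
    (f := fun x => ∑ i, ∑ j, x i * A i j * x j) (a := 0) (by fun_prop) (by
      intro x hx
      apply key
      intro h0
      have : x = 0 := by ext i; exact congrFun h0 i
      simp [this] at hx)
  refine ⟨c, hc, fun x => ?_⟩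
  by_cases hx : x = 0
  · simp [hx]
  set y : EuclideanSpace ℝ (Fin k) := WithLp.toLp 2 x with hy
  have hy0 : y ≠ 0 := by
    intro h; apply hx; ext i; exact congrArg (fun z : EuclideanSpace ℝ (Fin k) => z i) h
  have hn : 0 < ‖y‖ := norm_pos_iff.2 hy0
  have h1 := h (‖y‖⁻¹ • y) (by simp [norm_smul, hn.ne'])
  have h2 : ‖y‖ ^ 2 = ∑ i, x i ^ 2 := by simp [EuclideanSpace.norm_sq_eq, hy]
  have h3 : ∑ i, ∑ j, (‖y‖⁻¹ • y) i * A i j * (‖y‖⁻¹ • y) j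
      = (‖y‖ ^ 2)⁻¹ * ∑ i, ∑ j, x i * A i j * x j := by
    simp only [Finset.mul_sum]
    refine Finset.sum_congr rfl fun i _ => Finset.sum_congr rfl fun j _ => ?_
    simp [hy]; ring
  rw [h3, inv_mul_eq_div, le_div_iff₀ (by positivity), h2] at h1
  exact h1

lemma gauss_summable (c : ℝ) (hc : 0 < c) (a : ℝ) :
    Summable (fun n : ℤ => Real.exp (-π * (n + a) ^ 2 * c)) :=
  (HurwitzZeta.hasSum_int_evenKernel a hc).summable

lemma theta_exponent (k : ℕ) (τ' : Matrix (Fin k) (Fin k) ℂ) (b : Fin k → ℂ)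
    (εt δt : Fin k → ℤ) (y : ℤ) (t : ℝ) (n : Fin 1 ⊕ Fin k → ℤ) :
    Complex.exp ((π : ℂ) * Complex.I *
          ((∑ i, ∑ j, ((n i : ℂ) + ((Sum.elim (fun _ => (0 : ℤ)) εt) i : ℂ) / 2) *
              degMatrix k τ' b t i j *
              ((n j : ℂ) + ((Sum.elim (fun _ => (0 : ℤ)) εt) j : ℂ) / 2)) +
            ∑ i, ((n i : ℂ) + ((Sum.elim (fun _ => (0 : ℤ)) εt) i : ℂ) / 2) *
              ((Sum.elim (fun _ => y) δt) i : ℂ)))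
    = ((Real.exp (-π * (n (Sum.inl 0) : ℝ) ^ 2 * t) : ℝ) : ℂ) *
      Complex.exp ((π : ℂ) * Complex.I *
        (2 * (n (Sum.inl 0) : ℂ) * (∑ i, ((n (Sum.inr i) : ℂ) + (εt i : ℂ) / 2) * b i) +
          (∑ i, ∑ j, ((n (Sum.inr i) : ℂ) + (εt i : ℂ) / 2) * τ' i j *
            ((n (Sum.inr j) : ℂ) + (εt j : ℂ) / 2)) + (n (Sum.inl 0) : ℂ) * y +
          ∑ i, ((n (Sum.inr i) : ℂ) + (εt i : ℂ) / 2) * (δt i : ℂ))) := by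
  rw [Complex.ofReal_exp, ← Complex.exp_add]
  congr 1
  simp only [Fintype.sum_sum_type, Finset.univ_unique, Finset.sum_singleton, Fin.default_eq_zero,
    Sum.elim_inl, Sum.elim_inr, degMatrix, Matrix.fromBlocks_apply₁₁, Matrix.fromBlocks_apply₁₂,
    Matrix.fromBlocks_apply₂₁, Matrix.fromBlocks_apply₂₂, Matrix.of_apply, Finset.sum_add_distrib]
  have h1 : ∑ j, ((n (Sum.inl 0) : ℂ) + ((0 : ℤ) : ℂ) / 2) * b j *
      ((n (Sum.inr j) : ℂ) + (εt j : ℂ) / 2) =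
      (n (Sum.inl 0) : ℂ) * ∑ i, ((n (Sum.inr i) : ℂ) + (εt i : ℂ) / 2) * b i := by
    rw [Finset.mul_sum]
    refine Finset.sum_congr rfl fun i _ => ?_
    push_cast; ring
  have h2 : ∑ j, ((n (Sum.inr j) : ℂ) + (εt j : ℂ) / 2) * b j *
      ((n (Sum.inl 0) : ℂ) + ((0 : ℤ) : ℂ) / 2) =
      (n (Sum.inl 0) : ℂ) * ∑ i, ((n (Sum.inr i) : ℂ) + (εt i : ℂ) / 2) * b i := by
    rw [Finset.mul_sum]
    refine Finset.sum_congr rfl fun i _ => ?_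
    push_cast; ring
  rw [h1, h2]
  push_cast
  linear_combination (π : ℂ) * (n (Sum.inl 0) : ℂ) ^ 2 * t * Complex.I_sq

lemma theta_norm (k : ℕ) (τ' : Matrix (Fin k) (Fin k) ℂ) (b : Fin k → ℂ)
    (d : Fin k → ℤ) (a y : ℤ) (x : Fin k → ℝ) :
    ‖Complex.exp ((π : ℂ) * Complex.I *
        (2 * (a : ℂ) * (∑ i, (x i : ℂ) * b i) +
          (∑ i, ∑ j, (x i : ℂ) * τ' i j * (x j : ℂ)) + (a : ℂ) * y +
          ∑ i, (x i : ℂ) * (d i : ℂ)))‖ =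
    Real.exp (-π * (2 * a * (∑ i, x i * (b i).im) +
      ∑ i, ∑ j, x i * (τ'.map Complex.im) i j * x j)) := by
  rw [Complex.norm_exp]
  congr 1
  have hre : ∀ z : ℂ, ((π : ℂ) * Complex.I * z).re = -π * z.im := by intro z; simp
  rw [hre]
  congr 1
  have e1 : (2 * (a : ℂ) * (∑ i, (x i : ℂ) * b i)) =
      ((2 * a : ℝ) : ℂ) * (∑ i, (x i : ℂ) * b i) := by push_cast; ring
  have e2 : ∀ m : ℤ, (m : ℂ) = ((m : ℝ) : ℂ) := by intro m; simp
  have e3 : ∀ i j, ((x i : ℂ) * τ' i j * (x j : ℂ)).im = x i * (τ' i j).im * x j := by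
    intro i j; simp
  have e4 : ((a : ℂ) * y).im = 0 := by simp
  have e5 : ∀ i, ((x i : ℂ) * (d i : ℂ)).im = 0 := by intro i; simp
  rw [e1]
  simp only [Complex.add_im, Complex.im_ofReal_mul, Complex.im_sum, e3, e4, e5,
    Finset.sum_const_zero, add_zero, Matrix.map_apply]

lemma quad_bound {k : ℕ} (c : ℝ) (hc : 0 < c) (a : ℝ) (x β : Fin k → ℝ) (Q t : ℝ)
    (hQ : c * ∑ i, x i ^ 2 ≤ Q) (ht : 1 + 2 / c * ∑ i, β i ^ 2 ≤ t) :
    a ^ 2 + c / 2 * ∑ i, x i ^ 2 ≤ a ^ 2 * t + (2 * a * (∑ i, x i * β i) + Q) := by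
  have h1 : 0 ≤ ∑ i, (c / 2 * x i ^ 2 + 2 * a * (x i * β i) + 2 / c * a ^ 2 * β i ^ 2) := by
    refine Finset.sum_nonneg fun i _ => ?_
    have : c / 2 * x i ^ 2 + 2 * a * (x i * β i) + 2 / c * a ^ 2 * β i ^ 2
      = c / 2 * (x i + 2 / c * a * β i) ^ 2 := by field_simp; ring
    rw [this]; positivity
  rw [Finset.sum_add_distrib, Finset.sum_add_distrib, ← Finset.mul_sum, ← Finset.mul_sum,
    ← Finset.mul_sum] at h1
  have h2 := mul_le_mul_of_nonneg_left ht (sq_nonneg a)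
  linarith

/-- As `t → ∞`, a theta constant whose characteristic has first entry
`ε₁ = 0` (i.e. `ε = (0, ε̃)`, `δ = (y, δ̃)`), evaluated at the degenerating
period matrix `τ(t) = [[it, bᵀ], [b, τ']]`, converges to the genus-`k` theta
constant `θ[ε̃;δ̃](τ')`. -/
theorem theta_constant_limit_at_boundary (k : ℕ) (hk : 1 ≤ k)
    (τ' : Matrix (Fin k) (Fin k) ℂ) (hsym : τ'.IsSymm)
    (hpos : (τ'.map Complex.im).PosDef) (b : Fin k → ℂ)
    (εt δt : Fin k → ℤ) (hεt : ∀ i, εt i = 0 ∨ εt i = 1)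
    (hδt : ∀ i, δt i = 0 ∨ δt i = 1) (y : ℤ) (hy : y = 0 ∨ y = 1) :
    Filter.Tendsto
      (fun t : ℝ => ∑' n : Fin 1 ⊕ Fin k → ℤ,
        Complex.exp ((π : ℂ) * Complex.I *
          ((∑ i, ∑ j, ((n i : ℂ) + ((Sum.elim (fun _ => (0 : ℤ)) εt) i : ℂ) / 2) *
              degMatrix k τ' b t i j *
              ((n j : ℂ) + ((Sum.elim (fun _ => (0 : ℤ)) εt) j : ℂ) / 2)) +
            ∑ i, ((n i : ℂ) + ((Sum.elim (fun _ => (0 : ℤ)) εt) i : ℂ) / 2) *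
              ((Sum.elim (fun _ => y) δt) i : ℂ))))
      Filter.atTop
      (nhds (∑' m : Fin k → ℤ,
        Complex.exp ((π : ℂ) * Complex.I *
          ((∑ i, ∑ j, ((m i : ℂ) + (εt i : ℂ) / 2) * τ' i j * ((m j : ℂ) + (εt j : ℂ) / 2)) +
            ∑ i, ((m i : ℂ) + (εt i : ℂ) / 2) * (δt i : ℂ))))) := by
  simp_rw [theta_exponent]
  obtain ⟨c, hc, hQ⟩ := posdef_bound _ hpos
  set H : (Fin 1 ⊕ Fin k → ℤ) → ℂ := fun n => Complex.exp ((π : ℂ) * Complex.I *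
        (2 * (n (Sum.inl 0) : ℂ) * (∑ i, ((n (Sum.inr i) : ℂ) + (εt i : ℂ) / 2) * b i) +
          (∑ i, ∑ j, ((n (Sum.inr i) : ℂ) + (εt i : ℂ) / 2) * τ' i j *
            ((n (Sum.inr j) : ℂ) + (εt j : ℂ) / 2)) + (n (Sum.inl 0) : ℂ) * y +
          ∑ i, ((n (Sum.inr i) : ℂ) + (εt i : ℂ) / 2) * (δt i : ℂ))) with hH
  let g : (Fin 1 ⊕ Fin k → ℤ) → ℂ := fun n => if n (Sum.inl 0) = 0 then H n else 0
  let ι : (Fin k → ℤ) → (Fin 1 ⊕ Fin k → ℤ) := fun m => Sum.elim (fun _ => 0) m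
  have hι : Function.Injective ι := by
    intro m m' h
    ext i
    exact congrFun h (Sum.inr i)
  have hsupp : Function.support g ⊆ Set.range ι := by
    intro n hn
    have h0 : n (Sum.inl 0) = 0 := by
      by_contra h
      exact hn (by simp [g, h])
    refine ⟨fun i => n (Sum.inr i), ?_⟩
    ext i
    rcases i with i | i
    · rw [Subsingleton.elim i 0, h0]; rfl
    · rfl
  have hlim := hι.tsum_eq hsupp
  have hg : ∀ m, g (ι m) = Complex.exp ((π : ℂ) * Complex.I *
          ((∑ i, ∑ j, ((m i : ℂ) + (εt i : ℂ) / 2) * τ' i j * ((m j : ℂ) + (εt j : ℂ) / 2)) +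
            ∑ i, ((m i : ℂ) + (εt i : ℂ) / 2) * (δt i : ℂ))) := by
    intro m
    simp [g, ι, hH]
  simp_rw [← hg]
  rw [hlim]
  let f : Fin 1 ⊕ Fin k → ℤ → ℝ := Sum.elim (fun _ m => Real.exp (-π * (m + (0 : ℝ)) ^ 2 * 1))
    (fun i m => Real.exp (-π * (m + (εt i : ℝ) / 2) ^ 2 * (c / 2)))
  have hf := summable_pi_prod f
    (by rintro (i | i) m <;> exact (Real.exp_pos _).le)
    (by
      rintro (i | i)
      · exact gauss_summable 1 one_pos 0
      · exact gauss_summable (c / 2) (by positivity) _)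
  refine tendsto_tsum_of_dominated_convergence hf ?_ ?_
  · intro n
    by_cases h : n (Sum.inl 0) = 0
    · simp [g, h, hH]
    · simp only [g, h, if_false]
      rw [← zero_mul (H n), ← Complex.ofReal_zero]
      refine Filter.Tendsto.mul_const _ ?_
      refine (Complex.continuous_ofReal.tendsto 0).comp ?_
      refine Real.tendsto_exp_atBot.comp ?_
      refine Filter.Tendsto.const_mul_atTop_of_neg ?_ Filter.tendsto_id
      have h' : (n (Sum.inl 0) : ℝ) ≠ 0 := by exact_mod_cast h
      have : 0 < π * (n (Sum.inl 0) : ℝ) ^ 2 := by positivity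
      linarith
  · filter_upwards [Filter.eventually_ge_atTop (1 + 2 / c * ∑ i, (b i).im ^ 2)] with t ht n
    have hN := theta_norm k τ' b δt (n (Sum.inl 0)) y
      (fun i => (n (Sum.inr i) : ℝ) + (εt i : ℝ) / 2)
    push_cast at hN
    rw [norm_mul, hN, Complex.norm_real, Real.norm_eq_abs, abs_of_pos (Real.exp_pos _),
      ← Real.exp_add]
    have hb := quad_bound c hc (n (Sum.inl 0)) (fun i => (n (Sum.inr i) : ℝ) + (εt i : ℝ) / 2)
      (fun i => (b i).im) _ t (hQ _) ht
    have hp : ∏ i, f i (n i) = Real.exp (-π * ((n (Sum.inl 0) : ℝ) ^ 2 +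
        c / 2 * ∑ i, ((n (Sum.inr i) : ℝ) + (εt i : ℝ) / 2) ^ 2)) := by
      simp only [f, Fintype.prod_sum_type, Finset.univ_unique, Finset.prod_singleton,
        Fin.default_eq_zero, Sum.elim_inl, Sum.elim_inr]
      rw [← Real.exp_sum, ← Real.exp_add, mul_add, Finset.mul_sum, Finset.mul_sum]
      congr 2
      · ring
      · exact Finset.sum_congr rfl fun i _ => by ring
    rw [hp, Real.exp_le_exp]
    have := mul_le_mul_of_nonneg_left hb Real.pi_pos.le
    linarith
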